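/- Let M = (m_ij) ∈ ℤ^{d×d} satisfy m_ii = 0, m_ik ≤ m_ij + m_jk for all i, j, k, and be in standard form (m_ij ≥ 0 for all i, j and m_ij + m_ji > 0 for i ≠ j). Let u ∈ ℤ^d satisfy u_i − u_j ≤ m_ij for all i, j. Then the Λ_M-module L_u is projective if and only if there exist an index j and an integer c such that u_i = m_ij + c for all i, i.e., u is equivalent modulo ℤ·(1,…,1) to a column of M. -/

import Mathlib

set_option synthInstance.maxHeartbeats 400000
set_option maxHeartbeats 1600000

open scoped Pointwise

/-- The valuation ring `O_K` of a (surjective discrete) additive valuation on `K`. -/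
def valRing {K : Type*} [Field K] (v : AddValuation K (WithTop ℤ)) : Subring K where
  carrier := {x | 0 ≤ v x}
  zero_mem' := by simp only [Set.mem_setOf_eq, v.map_zero]; exact le_top
  one_mem' := by simp only [Set.mem_setOf_eq, v.map_one, le_refl]
  add_mem' := fun {a b} ha hb => v.map_le_add ha hb
  mul_mem' := fun {a b} ha hb => by
    simp only [Set.mem_setOf_eq, v.map_mul] at *
    exact add_nonneg ha hb
  neg_mem' := fun {a} ha => by simpa only [Set.mem_setOf_eq, v.map_neg] using ha

/-- The set `I_N = {X ∈ K^{d×d} : val(X) ≥ N}` (equal to `Λ_N` for suitable `N`). -/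
def matSet {K : Type*} [Field K] (v : AddValuation K (WithTop ℤ)) {d : ℕ}
    (N : Matrix (Fin d) (Fin d) ℤ) : Set (Matrix (Fin d) (Fin d) K) :=
  {X | ∀ i j, (N i j : WithTop ℤ) ≤ v (X i j)}

/-- The diagonal lattice `L_u = {x ∈ K^d : val(x_i) ≥ u_i}` as a set. -/
def latSet {K : Type*} [Field K] (v : AddValuation K (WithTop ℤ)) {d : ℕ}
    (u : Fin d → ℤ) : Set (Fin d → K) :=
  {x | ∀ i, (u i : WithTop ℤ) ≤ v (x i)}

/-- The diagonal lattice `L_u` as an `O_K`-submodule of `K^d`. -/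
def latSub {K : Type*} [Field K] (v : AddValuation K (WithTop ℤ)) {d : ℕ}
    (u : Fin d → ℤ) : Submodule (valRing v) (Fin d → K) where
  carrier := latSet v u
  zero_mem' := fun i => by simp only [Pi.zero_apply, v.map_zero]; exact le_top
  add_mem' := fun {x y} hx hy i => v.map_le_add (hx i) (hy i)
  smul_mem' := fun c x hx i => by
    have hc : (0 : WithTop ℤ) ≤ v (c : K) := c.2
    have hcx : (c • x) i = (c : K) * x i := rfl
    rw [hcx, v.map_mul]
    calc ((u i : ℤ) : WithTop ℤ) = 0 + (u i : ℤ) := by rw [zero_add]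
      _ ≤ v (c : K) + v (x i) := add_le_add hc (hx i)

/-- The graduated order `Λ_M` as a subring of the matrix ring. -/
def lamSubring {K : Type*} [Field K] (v : AddValuation K (WithTop ℤ)) {d : ℕ}
    (M : Matrix (Fin d) (Fin d) ℤ) (hdiag : ∀ i, M i i = 0)
    (htri : ∀ i j k, M i k ≤ M i j + M j k) :
    Subring (Matrix (Fin d) (Fin d) K) where
  carrier := matSet v M
  zero_mem' := fun i j => by simp only [Matrix.zero_apply, v.map_zero]; exact le_top
  one_mem' := fun i j => by
    rcases eq_or_ne i j with rfl | hij
    · rw [Matrix.one_apply_eq, v.map_one, hdiag i]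
      exact_mod_cast le_refl (0 : ℤ)
    · simp only [Matrix.one_apply_ne hij, v.map_zero]; exact le_top
  add_mem' := fun {X Y} hX hY i j => v.map_le_add (hX i j) (hY i j)
  neg_mem' := fun {X} hX i j => by
    simpa only [Matrix.neg_apply, v.map_neg] using hX i j
  mul_mem' := fun {X Y} hX hY i k => by
    rw [Matrix.mul_apply]
    apply v.map_le_sum
    intro j _
    rw [v.map_mul]
    calc ((M i k : ℤ) : WithTop ℤ) ≤ ((M i j + M j k : ℤ) : WithTop ℤ) := by
          exact_mod_cast htri i j k
      _ = ((M i j : ℤ) : WithTop ℤ) + ((M j k : ℤ) : WithTop ℤ) := by push_cast; rfl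
      _ ≤ v (X i j) + v (Y j k) := add_le_add (hX i j) (hY j k)

/-- Matrix-vector multiplication makes `L_u` a module over `Λ_M`. -/
def latSMul {K : Type*} [Field K] (v : AddValuation K (WithTop ℤ)) {d : ℕ}
    (M : Matrix (Fin d) (Fin d) ℤ) (hdiag : ∀ i, M i i = 0)
    (htri : ∀ i j k, M i k ≤ M i j + M j k)
    (u : Fin d → ℤ) (hu : ∀ i j, u i - u j ≤ M i j) :
    SMul (lamSubring v M hdiag htri) (latSub v u) :=
  ⟨fun X x => ⟨(X : Matrix (Fin d) (Fin d) K).mulVec (x : Fin d → K), by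
    intro i
    show ((u i : ℤ) : WithTop ℤ) ≤
      v (∑ j, (X : Matrix (Fin d) (Fin d) K) i j * (x : Fin d → K) j)
    apply v.map_le_sum
    intro j _
    rw [v.map_mul]
    calc ((u i : ℤ) : WithTop ℤ) ≤ ((M i j + u j : ℤ) : WithTop ℤ) := by
          have := hu i j; exact_mod_cast by omega
      _ = ((M i j : ℤ) : WithTop ℤ) + ((u j : ℤ) : WithTop ℤ) := by push_cast; rfl
      _ ≤ v ((X : Matrix (Fin d) (Fin d) K) i j) + v ((x : Fin d → K) j) :=
          add_le_add (X.2 i j) (x.2 j)⟩⟩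

/-- The `Λ_M`-module structure on the diagonal lattice `L_u`,
given by matrix-vector multiplication. -/
def latModule {K : Type*} [Field K] (v : AddValuation K (WithTop ℤ)) {d : ℕ}
    (M : Matrix (Fin d) (Fin d) ℤ) (hdiag : ∀ i, M i i = 0)
    (htri : ∀ i j k, M i k ≤ M i j + M j k)
    (u : Fin d → ℤ) (hu : ∀ i j, u i - u j ≤ M i j) :
    Module (lamSubring v M hdiag htri) (latSub v u) :=
  letI := latSMul v M hdiag htri u hu
  { one_smul := fun x => Subtype.ext (Matrix.one_mulVec (x : Fin d → K))
    mul_smul := fun X Y x => Subtype.ext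
      ((Matrix.mulVec_mulVec (x : Fin d → K) (X : Matrix (Fin d) (Fin d) K)
        (Y : Matrix (Fin d) (Fin d) K)).symm)
    smul_zero := fun X => Subtype.ext (Matrix.mulVec_zero (X : Matrix (Fin d) (Fin d) K))
    smul_add := fun X x y => Subtype.ext
      (Matrix.mulVec_add (X : Matrix (Fin d) (Fin d) K) (x : Fin d → K) (y : Fin d → K))
    add_smul := fun X Y x => Subtype.ext
      (Matrix.add_mulVec (X : Matrix (Fin d) (Fin d) K) (Y : Matrix (Fin d) (Fin d) K)
        (x : Fin d → K))
    zero_smul := fun x => Subtype.ext (Matrix.zero_mulVec (x : Fin d → K)) }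

section GraduatedOrder

variable {K : Type*} [Field K] {v : AddValuation K (WithTop ℤ)} {d : ℕ}

/-- A matrix with a single possibly nonzero entry `a` at `(k, l)` belongs to `Λ_M` as soon as
`val a ≥ m_kl`. -/
theorem single_mem_matSet {N : Matrix (Fin d) (Fin d) ℤ} {k l : Fin d} {a : K}
    (ha : (N k l : WithTop ℤ) ≤ v a) : Matrix.single k l a ∈ matSet v N := by
  intro i j
  by_cases h : k = i ∧ l = j
  · obtain ⟨rfl, rfl⟩ := h
    rwa [Matrix.single_apply_same]
  · rw [Matrix.single_apply_of_ne (h := h), v.map_zero]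
    exact le_top

/-- A vector with a single possibly nonzero entry `x` at `k` belongs to `L_u` as soon as
`val x ≥ u_k`. -/
theorem pi_single_mem_latSub {u : Fin d → ℤ} {k : Fin d} {x : K}
    (hx : (u k : WithTop ℤ) ≤ v x) : Pi.single k x ∈ latSub v u := by
  intro i
  rcases eq_or_ne i k with rfl | h
  · rwa [Pi.single_eq_same]
  · rw [Pi.single_eq_of_ne h, v.map_zero]
    exact le_top

/-- If a finite sum has valuation at most `g`, then so does one of its terms. -/
theorem exists_map_le_of_map_sum_le {ι : Type*} {s : Finset ι} {f : ι → K} {g : ℤ}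
    (h : v (∑ i ∈ s, f i) ≤ g) : ∃ i ∈ s, v (f i) ≤ g := by
  by_contra! hc
  exact absurd h (not_le.mpr (v.map_lt_sum WithTop.coe_ne_top hc))

variable {M : Matrix (Fin d) (Fin d) ℤ} {hdiag : ∀ i, M i i = 0}
  {htri : ∀ i j k, M i k ≤ M i j + M j k} {u : Fin d → ℤ} {hu : ∀ i j, u i - u j ≤ M i j}

/-- If `u` is a translate of the `j`-th column of `M`, then `L_u` is isomorphic to the direct
summand of `Λ_M` of matrices supported on column `j`, hence projective. -/
theorem projective_latSub_of_eq_column (hv : Function.Surjective v) {j : Fin d} {c : ℤ}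
    (h : ∀ i, u i = M i j + c) :
    @Module.Projective (lamSubring v M hdiag htri) _ (latSub v u) _
      (latModule v M hdiag htri u hu) := by
  let := latModule v M hdiag htri u hu
  obtain ⟨a, ha⟩ := hv (c : ℤ)
  have ha0 : a ≠ 0 := by
    rintro rfl
    rw [v.map_zero] at ha
    exact WithTop.top_ne_coe ha
  have haj : (u j : WithTop ℤ) ≤ v a := by rw [h j, hdiag j, zero_add, ha]
  let incl : latSub v u →ₗ[lamSubring v M hdiag htri] lamSubring v M hdiag htri :=
    { toFun := fun x => ⟨Matrix.of fun i k => if k = j then a⁻¹ * (x : Fin d → K) i else 0, by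
        intro i k
        rw [Matrix.of_apply]
        split_ifs with hk
        · subst hk
          have hx : (u i : WithTop ℤ) ≤ v ((x : Fin d → K) i) := x.2 i
          have hmul : v ((x : Fin d → K) i) = c + v (a⁻¹ * (x : Fin d → K) i) := by
            rw [← ha, ← v.map_mul, mul_inv_cancel_left₀ ha0]
          rw [hmul, h i, add_comm (M i k), WithTop.coe_add] at hx
          exact (WithTop.add_le_add_iff_left WithTop.coe_ne_top).mp hx
        · rw [v.map_zero]
          exact le_top⟩
      map_add' := fun x y => Subtype.ext <| Matrix.ext fun i k => by
        change (if k = j then a⁻¹ * ((x : Fin d → K) i + (y : Fin d → K) i) else 0) =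
          (if k = j then a⁻¹ * (x : Fin d → K) i else 0) +
            (if k = j then a⁻¹ * (y : Fin d → K) i else 0)
        split_ifs <;> ring
      map_smul' := fun X x => Subtype.ext <| Matrix.ext fun i k => by
        change (if k = j then a⁻¹ * ∑ l, (X : Matrix (Fin d) (Fin d) K) i l *
            (x : Fin d → K) l else 0) =
          ∑ l, (X : Matrix (Fin d) (Fin d) K) i l *
            (if k = j then a⁻¹ * (x : Fin d → K) l else 0)
        split_ifs
        · rw [Finset.mul_sum]
          exact Finset.sum_congr rfl fun l _ => by ring
        · simp }
  refine Module.Projective.of_split incl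
    (LinearMap.toSpanSingleton _ _ (⟨Pi.single j a, pi_single_mem_latSub haj⟩ : latSub v u)) ?_
  ext x i
  change ∑ k, (if k = j then a⁻¹ * (x : Fin d → K) i else 0) *
    (Pi.single j a : Fin d → K) k = (x : Fin d → K) i
  rw [Finset.sum_eq_single j (fun k _ hk => by simp [hk]) (by simp)]
  simp only [if_true, Pi.single_eq_same]
  field_simp

/-- A `Λ_M`-linear map `f : L_u → Λ_M` is `x ↦ x yᵀ` for some row vector `y`; this is the resulting
relation between the entries of the images of multiples of standard basis vectors. -/
theorem mul_apply_single_eq (hv : Function.Surjective v) {k l : Fin d} {x y : K}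
    (hx : v x = u l) (hy : v y = u k) (j : Fin d) :
    letI := latModule v M hdiag htri u hu
    ∀ f : latSub v u →ₗ[lamSubring v M hdiag htri] lamSubring v M hdiag htri,
      x * (f ⟨Pi.single k y, pi_single_mem_latSub hy.ge⟩ : Matrix (Fin d) (Fin d) K) k j =
        y * (f ⟨Pi.single l x, pi_single_mem_latSub hx.ge⟩ : Matrix (Fin d) (Fin d) K) l j := by
  let := latModule v M hdiag htri u hu
  intro f
  obtain ⟨a, ha⟩ := hv (M k l : ℤ)
  have ne_zero : ∀ {z : K} {n : ℤ}, v z = n → z ≠ 0 := by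
    rintro z n hz rfl
    rw [v.map_zero] at hz
    exact WithTop.top_ne_coe hz
  have ha0 := ne_zero ha
  have hy0 := ne_zero hy
  set b := a * x / y
  have hby : b * y = a * x := div_mul_cancel₀ _ hy0
  have hbv : (M k k : WithTop ℤ) ≤ v b := by
    refine (WithTop.add_le_add_iff_right (WithTop.coe_ne_top (a := u k))).mp ?_
    rw [← hy, ← v.map_mul, hby, v.map_mul, hx, hy, ha, hdiag]
    have := hu k l
    exact_mod_cast (by omega : 0 + u k ≤ M k l + u l)
  let A : lamSubring v M hdiag htri := ⟨Matrix.single k l a, single_mem_matSet ha.ge⟩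
  let B : lamSubring v M hdiag htri := ⟨Matrix.single k k b, single_mem_matSet hbv⟩
  have hAB : B • (⟨Pi.single k y, pi_single_mem_latSub hy.ge⟩ : latSub v u) =
      A • (⟨Pi.single l x, pi_single_mem_latSub hx.ge⟩ : latSub v u) := by
    refine Subtype.ext ?_
    change (Matrix.single k k b).mulVec (Pi.single k y) =
      (Matrix.single k l a).mulVec (Pi.single l x)
    ext i
    simp [Matrix.mulVec_single, Matrix.single_apply, hby]
  have hf := congrArg f hAB
  rw [map_smul, map_smul] at hf
  have hentry := congrFun (congrFun (congrArg Subtype.val hf) k) j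
  change (Matrix.single k k b * (f _ : Matrix (Fin d) (Fin d) K)) k j =
    (Matrix.single k l a * (f _ : Matrix (Fin d) (Fin d) K)) k j at hentry
  rw [Matrix.single_mul_apply_same, Matrix.single_mul_apply_same] at hentry
  refine mul_left_cancel₀ ha0 ?_
  linear_combination y * hentry - (f ⟨Pi.single k y, pi_single_mem_latSub hy.ge⟩ :
    Matrix (Fin d) (Fin d) K) k j * hby

/-- If `L_u` is projective over `Λ_M`, then `u` is a translate of a column of `M`. -/
theorem exists_eq_column_of_projective_latSub (hv : Function.Surjective v) (hd : 0 < d)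
    (h : @Module.Projective (lamSubring v M hdiag htri) _ (latSub v u) _
      (latModule v M hdiag htri u hu)) :
    ∃ (j : Fin d) (c : ℤ), ∀ i, u i = M i j + c := by
  let := latModule v M hdiag htri u hu
  let l : Fin d := ⟨0, hd⟩
  obtain ⟨s, hs⟩ := Module.projective_def'.mp h
  obtain ⟨x, hx⟩ := hv (u l : ℤ)
  let e : latSub v u := ⟨Pi.single l x, pi_single_mem_latSub hx.ge⟩
  have hsum : ∑ m ∈ (s e).support, s e m • m = e := by
    simpa [Finsupp.linearCombination_apply, Finsupp.sum] using LinearMap.congr_fun hs e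
  have hcoord : ∑ m ∈ (s e).support,
      ∑ j, (s e m : Matrix (Fin d) (Fin d) K) l j * (m : Fin d → K) j = x := by
    have h1 := congrFun (congrArg (latSub v u).subtype.toAddMonoidHom hsum) l
    rw [map_sum, Finset.sum_apply] at h1
    exact h1.trans (Pi.single_eq_same (M := fun _ => K) l x)
  obtain ⟨m, -, hm⟩ := exists_map_le_of_map_sum_le (hcoord ▸ hx.le)
  obtain ⟨j, -, hj⟩ := exists_map_le_of_map_sum_le hm
  refine ⟨j, u j, fun k => ?_⟩
  obtain ⟨y, hy⟩ := hv (u k : ℤ)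
  let f : latSub v u →ₗ[lamSubring v M hdiag htri] lamSubring v M hdiag htri :=
    Finsupp.lapply m ∘ₗ s
  let G := (f ⟨Pi.single k y, pi_single_mem_latSub hy.ge⟩ : Matrix (Fin d) (Fin d) K) k j
  let F := (f e : Matrix (Fin d) (Fin d) K) l j
  have hGF : x * G = y * F := mul_apply_single_eq hv hx hy j f
  have hG : (M k j : WithTop ℤ) ≤ v G := (f ⟨Pi.single k y, _⟩).2 k j
  have hF : v F + (u j : WithTop ℤ) ≤ u l :=
    (add_le_add_right (m.2 j) (v F)).trans ((v.map_mul _ _).symm.le.trans hj)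
  have hle : ((u l + M k j + u j : ℤ) : WithTop ℤ) ≤ ((u k + u l : ℤ) : WithTop ℤ) := by
    push_cast
    calc (u l : WithTop ℤ) + M k j + u j ≤ v x + v G + u j := by rw [hx]; gcongr
      _ = v y + v F + u j := by rw [← v.map_mul, hGF, v.map_mul]
      _ = u k + (v F + u j) := by rw [hy, add_assoc]
      _ ≤ u k + u l := by gcongr
  have hle' := WithTop.coe_le_coe.mp hle
  have := hu k j
  omega

end GraduatedOrder

/-- Let `M` be a graduated-order matrix in standard form, and let
`u ∈ ℤ^d` satisfy `u_i - u_j ≤ m_ij`. The `Λ_M`-module `L_u` is projective if and only if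
`u` is, modulo `ℤ·(1,…,1)`, a column of `M`. -/
theorem diagonal_lattice_projective_iff {K : Type*} [Field K]
    (v : AddValuation K (WithTop ℤ)) (hv : Function.Surjective v)
    (d : ℕ) (hd : 0 < d)
    (M : Matrix (Fin d) (Fin d) ℤ) (hdiag : ∀ i, M i i = 0)
    (htri : ∀ i j k, M i k ≤ M i j + M j k)
    (hstd1 : ∀ i j, 0 ≤ M i j) (hstd2 : ∀ i j, i ≠ j → 0 < M i j + M j i)
    (u : Fin d → ℤ) (hu : ∀ i j, u i - u j ≤ M i j) :
    (@Module.Projective (lamSubring v M hdiag htri) _ (latSub v u) _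
        (latModule v M hdiag htri u hu)) ↔
      ∃ (j : Fin d) (c : ℤ), ∀ i, u i = M i j + c := by
  exact ⟨exists_eq_column_of_projective_latSub hv hd,
    fun ⟨_, _, h⟩ => projective_latSub_of_eq_column hv h⟩
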